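/- In G₁₁ set x = t⁻¹·s·t and q = u⁻¹·z³, and let G₁₃ be the subgroup generated by s, u² and x. Then x = u·s·u⁻¹, q = s·x·u²·s = x·u²·s·x, q·x = s·q, u²·q = q·u², u²·q² = z⁶ = (s·x·u²)³ = (x·u²·s)³, the center of G₁₃ equals the cyclic subgroup generated by z⁶ (which has order 4), and Z(G₁₃) = G₁₃ ∩ Z(G₁₁); moreover, with Z₁₃ = {1, z⁶, z¹², z¹⁸}, V = {1, u²}, and X₁₃ = {1, s, q·x⁻¹·s⁻¹, q·x⁻¹, s·u², s·u²·s, q, q·s, s·u²·q, s·u²·q·s, q·s·u², q·s·u²·s}, the map Z₁₃ × V × X₁₃ → G₁₃ sending (y, v, x') to y·v·x' is a bijection onto G₁₃. -/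

import Mathlib

open Pointwise

namespace Octa

def rels : Set (FreeGroup (Fin 3)) :=
  { FreeGroup.of 0 ^ 2, FreeGroup.of 1 ^ 3, FreeGroup.of 2 ^ 4,
    FreeGroup.of 0 * FreeGroup.of 1 * FreeGroup.of 2 *
      (FreeGroup.of 1 * FreeGroup.of 2 * FreeGroup.of 0)⁻¹,
    FreeGroup.of 0 * FreeGroup.of 1 * FreeGroup.of 2 *
      (FreeGroup.of 2 * FreeGroup.of 0 * FreeGroup.of 1)⁻¹ }

/-- The group `G₁₁ = ⟨s, t, u | s² = t³ = u⁴ = 1, stu = tus = ust⟩`. -/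
abbrev G11 := PresentedGroup rels

def s : G11 := PresentedGroup.of 0
def t : G11 := PresentedGroup.of 1
def u : G11 := PresentedGroup.of 2
def z : G11 := s * t * u

def x : G11 := t⁻¹ * s * t
def q : G11 := u⁻¹ * z ^ 3
def G13 : Subgroup G11 := Subgroup.closure {s, u ^ 2, x}

set_option linter.unusedSimpArgs false

section
variable {G : Type*} [Group G]

structure Rules (s u w : G) : Prop where
  sw : s * w = w * s
  uw : u * w = w * u
  ss : s * s = 1
  u4 : u * (u * (u * u)) = 1
  w8 : w * (w * (w * (w * (w * (w * (w * w)))))) = 1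
  r1 : u * (s * (u * s)) = w * (s * (u * (u * u)))
  r2 : u * (u * (u * s)) = w * (w * (w * (w * (w * (w * (w * (s * (u * (s * u)))))))))
  r3 : u * (u * (s * (u * (u * u)))) =
    w * (w * (w * (w * (w * (w * (s * (u * (s * (u * (u * s))))))))))
  r4 : u * (u * (s * (u * (u * s)))) = w * (w * (w * (w * (s * (u * (u * (s * (u * u))))))))
  r5 : u * (s * (u * (u * (s * u)))) = w * (w * (s * (u * (u * s))))

theorem rules_of {s u w : G} (hs : s ^ 2 = 1) (hu : u ^ 4 = 1) (sw : s * w = w * s)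
    (uw : u * w = w * u) (h : (u * s) ^ 3 = w) : Rules s u w := by
  have ss : s * s = 1 := by rw [← pow_two, hs]
  have ss' : ∀ a, s * (s * a) = a := fun a => by rw [← mul_assoc, ss, one_mul]
  have sw' : ∀ a, s * (w * a) = w * (s * a) := fun a => by rw [← mul_assoc, sw, mul_assoc]
  have uw' : ∀ a, u * (w * a) = w * (u * a) := fun a => by rw [← mul_assoc, uw, mul_assoc]
  have u4 : u * (u * (u * u)) = 1 := by
    rw [← hu]; simp only [pow_succ, pow_zero, one_mul, mul_assoc]
  have u4' : ∀ a, u * (u * (u * (u * a))) = a := fun a => by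
    have := congrArg (· * a) u4
    simpa [mul_assoc] using this
  have h6 : u * (s * (u * (s * (u * s)))) = w := by rw [← h]; simp only [pow_succ, pow_zero, one_mul, mul_assoc]
  have r1' : ∀ a, u * (s * (u * (s * a))) = w * (s * (u * (u * (u * a)))) := fun a => by
    have := congrArg (· * (s * (u * (u * (u * a))))) h6
    simpa only [mul_assoc, ss', u4'] using this
  have r1 : u * (s * (u * s)) = w * (s * (u * (u * u))) := by simpa using r1' 1
  have r2' : ∀ a, w * (u * (u * (u * (s * a)))) = s * (u * (s * (u * a))) := fun a => by
    have := congrArg (fun b => u * (u * (u * b))) (r1' (s * (u * a)))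
    simp only [uw', ss', u4'] at this
    have := congrArg (fun b => s * b) (r1' (s * a))
    simp only [ss', sw'] at this
    exact this.symm
  have r3' : ∀ a, w * (w * (u * (u * (s * (u * (u * (u * a))))))) =
      s * (u * (s * (u * (u * (s * a))))) := fun a => by
    have h1 := r1' a
    have h2 := congrArg (fun b => w * (u * (u * b))) h1
    simp only [uw'] at h2
    rw [← h2, r2']
  have r5' : ∀ a, u * (s * (u * (u * (s * (u * a))))) = w * (w * (s * (u * (u * (s * a))))) :=
    fun a => by
      have h1 := congrArg (fun b => s * b) (r3' (u * a))
      simp only [sw', ss', u4'] at h1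
      exact h1.symm
  have key : ∀ a, s * (u * (u * (s * (u * (u * (s * (u * (u * (s * (u * (u * a))))))))))) =
      w * (w * (w * (w * a))) := fun a => by
    have e : ∀ a, s * (u * (u * (s * (u * (u * a))))) =
        w * (w * (u * (u * (u * (s * (u * (u * (s * (u * a))))))))) := fun a => by
      have h1 := congrArg (fun b => u * (u * (u * b))) (r5' (u * a))
      simp only [u4', uw'] at h1
      exact h1
    rw [e, e]
    simp only [uw', sw', ss', u4']
  have w8' : ∀ a, w * (w * (w * (w * (w * (w * (w * (w * a))))))) = a := fun a => by
    have h5 : ∀ a, s * (u * (u * (s * (u * (u * (s * (u * (u * (s * a))))))))) =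
        w * (w * (w * (w * (u * (u * a))))) := fun a => by
      simpa only [u4'] using key (u * (u * a))
    symm
    calc a = s * (u * (u * (s * (u * (u * (s * (u * (u * (s * (s * (u * (u * (s * (u * (u *
        (s * (u * (u * (s * a))))))))))))))))))) := by simp only [ss', u4']
      _ = _ := by
        rw [h5, h5]
        simp only [uw', u4']
  have w8 : w * (w * (w * (w * (w * (w * (w * w)))))) = 1 := by simpa using w8' 1
  refine ⟨sw, uw, ss, u4, w8, r1, ?_, ?_, ?_, ?_⟩
  · have := r2' 1
    simp only [mul_one] at this
    rw [← this, w8']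
  · have := r3' 1
    simp only [mul_one] at this
    rw [← this, w8']
  · have := key (u * (u * (s * (u * (u * s)))))
    simp only [ss', ss, mul_one, u4'] at this
    rw [this, w8']
  · simpa using r5' 1

def tabS : Fin 24 → Fin 24 :=
  ![1, 0, 3, 2, 5, 4, 7, 6, 9, 8, 11, 10, 13, 12, 15, 14, 17, 16, 19, 18, 21, 20, 23, 22]
def tabV : Fin 24 → Fin 24 :=
  ![12, 4, 21, 8, 1, 17, 18, 10, 3, 14, 7, 23, 0, 16, 9, 20, 13, 5, 6, 22, 15, 2, 19, 11]
def expV : Fin 24 → ℕ :=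
  ![0, 0, 3, 0, 0, 2, 0, 0, 0, 1, 0, 2, 0, 0, 3, 0, 0, 2, 0, 0, 0, 1, 0, 2]
def tabX : Fin 24 → Fin 24 :=
  ![21, 10, 17, 6, 19, 14, 3, 16, 23, 12, 1, 20, 9, 22, 5, 18, 7, 2, 15, 4, 11, 0, 13, 8]
def expX : Fin 24 → ℕ :=
  ![3, 0, 3, 0, 3, 1, 0, 1, 3, 1, 0, 1, 3, 0, 3, 0, 3, 1, 0, 1, 3, 1, 0, 1]

/-- The 24 products of V and X. -/
def wordE (s u x q : G) : Fin 24 → G :=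
  ![1, s, q * x⁻¹ * s⁻¹, q * x⁻¹, s * u ^ 2, s * u ^ 2 * s, q, q * s, s * u ^ 2 * q,
    s * u ^ 2 * q * s, q * s * u ^ 2, q * s * u ^ 2 * s,
    u ^ 2 * 1, u ^ 2 * s, u ^ 2 * (q * x⁻¹ * s⁻¹), u ^ 2 * (q * x⁻¹), u ^ 2 * (s * u ^ 2),
    u ^ 2 * (s * u ^ 2 * s), u ^ 2 * q, u ^ 2 * (q * s), u ^ 2 * (s * u ^ 2 * q),
    u ^ 2 * (s * u ^ 2 * q * s), u ^ 2 * (q * s * u ^ 2), u ^ 2 * (q * s * u ^ 2 * s)]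

theorem table {s u w x q : G} (R : Rules s u w) (hx : x = u * s * u⁻¹) (hq : q = u⁻¹ * w)
    (i : Fin 24) :
    wordE s u x q i * s = wordE s u x q (tabS i) ∧
    wordE s u x q i * u ^ 2 = (w ^ 2) ^ expV i * wordE s u x q (tabV i) ∧
    wordE s u x q i * x = (w ^ 2) ^ expX i * wordE s u x q (tabX i) := by
  obtain ⟨sw, uw, ss, u4, w8, r1, r2, r3, r4, r5⟩ := R
  have ext : ∀ {a b : G}, a = b → ∀ c, a * c = b * c := fun h c => by rw [h]
  have si : s⁻¹ = s := inv_eq_of_mul_eq_one_left ss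
  have ui : u⁻¹ = u * (u * u) := inv_eq_of_mul_eq_one_right u4
  have xi : x⁻¹ = u * (s * (u * (u * u))) := by
    rw [hx, mul_inv_rev, mul_inv_rev, inv_inv, si, ui]
  have hx' : x = u * (s * (u * (u * u))) := by rw [hx, ui, mul_assoc]
  have sw' := ext sw
  have uw' := ext uw
  have ss' := ext ss
  have u4' := ext u4
  have w8' := ext w8
  have r1' := ext r1
  have r2' := ext r2
  have r3' := ext r3
  have r4' := ext r4
  have r5' := ext r5
  simp only [mul_assoc, one_mul] at sw' uw' ss' u4' w8' r1' r2' r3' r4' r5'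
  have hq' : q = w * (u * (u * u)) := by rw [hq, ui]; simp only [mul_assoc, uw, uw']
  fin_cases i <;>
  · simp only [wordE, tabS, tabV, tabX, expV, expX, Fin.reduceFinMk, Matrix.cons_val, xi, si]
    simp only [hx', hq', pow_succ, pow_zero, one_mul, mul_one, mul_assoc, sw', uw', ss', u4', w8',
      r1', r2', r3', r4', r5', sw, uw, ss, u4, w8, r1, r2, r3, r4, r5, and_self]

theorem idents {s u w x q : G} (R : Rules s u w) (hx : x = u * s * u⁻¹) (hq : q = u⁻¹ * w) :
    q = s * x * u ^ 2 * s ∧ q = x * u ^ 2 * s * x ∧ q * x = s * q ∧ u ^ 2 * q = q * u ^ 2 ∧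
    u ^ 2 * q ^ 2 = w ^ 2 ∧ w ^ 2 = (s * x * u ^ 2) ^ 3 ∧ w ^ 2 = (x * u ^ 2 * s) ^ 3 ∧
    w ^ 8 = 1 := by
  obtain ⟨sw, uw, ss, u4, w8, r1, r2, r3, r4, r5⟩ := R
  have ext : ∀ {a b : G}, a = b → ∀ c, a * c = b * c := fun h c => by rw [h]
  have ui : u⁻¹ = u * (u * u) := inv_eq_of_mul_eq_one_right u4
  have hx' : x = u * (s * (u * (u * u))) := by rw [hx, ui, mul_assoc]
  have sw' := ext sw
  have uw' := ext uw
  have ss' := ext ss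
  have u4' := ext u4
  have w8' := ext w8
  have r1' := ext r1
  have r2' := ext r2
  have r3' := ext r3
  have r4' := ext r4
  have r5' := ext r5
  simp only [mul_assoc, one_mul] at sw' uw' ss' u4' w8' r1' r2' r3' r4' r5'
  have hq' : q = w * (u * (u * u)) := by rw [hq, ui]; simp only [mul_assoc, uw, uw']
  refine ⟨?_, ?_, ?_, ?_, ?_, ?_, ?_, ?_⟩ <;>
  · simp only [hx', hq', pow_succ, pow_zero, one_mul, mul_one, mul_assoc, sw', uw', ss', u4', w8',
      r1', r2', r3', r4', r5', sw, uw, ss, u4, w8, r1, r2, r3, r4, r5]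

def wordV (u : G) : Fin 2 → G := ![1, u ^ 2]

def wordX (s u x q : G) : Fin 12 → G :=
  ![1, s, q * x⁻¹ * s⁻¹, q * x⁻¹, s * u ^ 2, s * u ^ 2 * s, q, q * s, s * u ^ 2 * q,
    s * u ^ 2 * q * s, q * s * u ^ 2, q * s * u ^ 2 * s]

theorem wordE_eq (s u x q : G) (i : Fin 24) :
    ∃ j k, wordE s u x q i = wordV u j * wordX s u x q k := by
  refine ⟨⟨i / 12, by omega⟩, ⟨i % 12, by omega⟩, ?_⟩
  fin_cases i <;> first | rfl | exact (one_mul _).symm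

theorem map_wordV {H : Type*} [Group H] (f : G →* H) (u : G) (j : Fin 2) :
    f (wordV u j) = wordV (f u) j := by
  fin_cases j <;> simp [wordV]

theorem map_wordX {H : Type*} [Group H] (f : G →* H) (s u x q : G) (k : Fin 12) :
    f (wordX s u x q k) = wordX (f s) (f u) (f x) (f q) k := by
  fin_cases k <;> simp [wordX]

theorem mem_V {u v : G} (h : v ∈ ({1, u ^ 2} : Set G)) : ∃ j, v = wordV u j := by
  rcases h with h | h
  · exact ⟨0, h⟩
  · exact ⟨1, h⟩

theorem wordV_mem (u : G) (j : Fin 2) : wordV u j ∈ ({1, u ^ 2} : Set G) := by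
  fin_cases j <;> simp [wordV]

theorem mem_X {s u x q g : G} (h : g ∈ ({1, s, q * x⁻¹ * s⁻¹, q * x⁻¹, s * u ^ 2, s * u ^ 2 * s, q,
    q * s, s * u ^ 2 * q, s * u ^ 2 * q * s, q * s * u ^ 2, q * s * u ^ 2 * s} : Set G)) :
    ∃ k, g = wordX s u x q k := by
  rcases h with h | h | h | h | h | h | h | h | h | h | h | h
  exacts [⟨0, h⟩, ⟨1, h⟩, ⟨2, h⟩, ⟨3, h⟩, ⟨4, h⟩, ⟨5, h⟩, ⟨6, h⟩, ⟨7, h⟩, ⟨8, h⟩, ⟨9, h⟩, ⟨10, h⟩,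
    ⟨11, h⟩]

theorem wordX_mem (s u x q : G) (k : Fin 12) : wordX s u x q k ∈ ({1, s, q * x⁻¹ * s⁻¹, q * x⁻¹,
    s * u ^ 2, s * u ^ 2 * s, q, q * s, s * u ^ 2 * q, s * u ^ 2 * q * s, q * s * u ^ 2,
    q * s * u ^ 2 * s} : Set G) := by
  fin_cases k <;> simp [wordX]
end

/-! Facts in `G11`. -/

theorem s_sq : s ^ 2 = 1 := by
  have := PresentedGroup.one_of_mem (rels := rels) (x := FreeGroup.of 0 ^ 2) (by simp [rels])
  exact this

theorem t_cube : t ^ 3 = 1 := by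
  have := PresentedGroup.one_of_mem (rels := rels) (x := FreeGroup.of 1 ^ 3) (by simp [rels])
  exact this

theorem u_four : u ^ 4 = 1 := by
  have := PresentedGroup.one_of_mem (rels := rels) (x := FreeGroup.of 2 ^ 4) (by simp [rels])
  exact this

theorem z_eq1 : z = t * u * s := by
  have := PresentedGroup.one_of_mem (rels := rels)
    (x := FreeGroup.of 0 * FreeGroup.of 1 * FreeGroup.of 2 *
      (FreeGroup.of 1 * FreeGroup.of 2 * FreeGroup.of 0)⁻¹) (by simp [rels])
  rw [map_mul, map_inv, mul_inv_eq_one] at this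
  exact this

theorem z_eq2 : z = u * s * t := by
  have := PresentedGroup.one_of_mem (rels := rels)
    (x := FreeGroup.of 0 * FreeGroup.of 1 * FreeGroup.of 2 *
      (FreeGroup.of 2 * FreeGroup.of 0 * FreeGroup.of 1)⁻¹) (by simp [rels])
  rw [map_mul, map_inv, mul_inv_eq_one] at this
  exact this

theorem sz : s * z = z * s := by
  conv_lhs => rw [z_eq1]
  simp only [z, mul_assoc]

theorem uz : u * z = z * u := by
  conv_rhs => rw [z_eq2]
  simp only [z, mul_assoc]

theorem tz : t * z = z * t := by
  conv_lhs => rw [z_eq2]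
  rw [z_eq1]
  simp only [mul_assoc]

theorem closure_gens : Subgroup.closure {s, t, u} = (⊤ : Subgroup G11) := by
  rw [eq_top_iff, ← PresentedGroup.closure_range_of rels, Subgroup.closure_le]
  rintro _ ⟨i, rfl⟩
  fin_cases i
  · exact Subgroup.subset_closure (by simp [s])
  · exact Subgroup.subset_closure (by simp [t])
  · exact Subgroup.subset_closure (by simp [u])

theorem z_central : z ∈ Subgroup.center G11 := by
  have h : Subgroup.closure {s, t, u} ≤ Subgroup.centralizer {z} := by
    rw [Subgroup.closure_le]
    rintro g (rfl | rfl | rfl) <;> rw [SetLike.mem_coe, Subgroup.mem_centralizer_singleton_iff]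
    exacts [sz, tz, uz]
  rw [closure_gens] at h
  rw [Subgroup.mem_center_iff]
  intro g
  exact Subgroup.mem_centralizer_singleton_iff.1 (h (Subgroup.mem_top g))

theorem z_comm (n : ℕ) (g : G11) : g * z ^ n = z ^ n * g :=
  Subgroup.mem_center_iff.1 (pow_mem z_central n) g

theorem us_cube : (u * s) ^ 3 = z ^ 3 := by
  have h : u * s = z * t⁻¹ := by rw [z_eq2]; group
  have h2 : Commute z t⁻¹ := (show Commute z t from tz.symm).inv_right
  rw [h, h2.mul_pow, inv_pow, t_cube, inv_one, mul_one]

theorem x_eq : x = u * s * u⁻¹ := by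
  have h : t = s⁻¹ * z * u⁻¹ := by rw [z]; group
  have hz : z⁻¹ * s * z = s := by rw [mul_assoc, sz, inv_mul_cancel_left]
  have h1 : x = u * (z⁻¹ * s * z) * u⁻¹ := by
    rw [x, h]
    have := sz
    have e : s * z * s⁻¹ = z := by rw [sz, mul_inv_cancel_right]
    calc (s⁻¹ * z * u⁻¹)⁻¹ * s * (s⁻¹ * z * u⁻¹) = u * (z⁻¹ * s * z) * u⁻¹ := by group
      _ = _ := rfl
  rw [h1, hz]

theorem rulesG : Rules s u (z ^ 3) :=
  rules_of s_sq u_four (z_comm 3 s) (z_comm 3 u) us_cube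

/-! The homomorphism onto the symmetric group of degree 4. -/

abbrev sP : Equiv.Perm (Fin 4) := Equiv.swap 0 1
abbrev uP : Equiv.Perm (Fin 4) := finRotate 4

def toP : G11 →* Equiv.Perm (Fin 4) :=
  PresentedGroup.toGroup (f := ![sP, sP⁻¹ * uP⁻¹, uP]) (by
    rintro r (rfl | rfl | rfl | rfl | rfl) <;> simp <;> decide +kernel)

theorem toP_s : toP s = sP := PresentedGroup.toGroup.of _
theorem toP_t : toP t = sP⁻¹ * uP⁻¹ := PresentedGroup.toGroup.of _
theorem toP_u : toP u = uP := PresentedGroup.toGroup.of _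
theorem toP_z : toP z = 1 := by simp only [z, map_mul, toP_s, toP_t, toP_u]; group
theorem toP_x : toP x = uP * sP * uP⁻¹ := by rw [x_eq]; simp only [map_mul, map_inv, toP_s, toP_u]
theorem toP_q : toP q = uP⁻¹ := by
  simp only [q, map_mul, map_inv, map_pow, toP_u, toP_z, one_pow, mul_one]

theorem perm_inj : Function.Injective (fun p : Fin 2 × Fin 12 =>
    wordV uP p.1 * wordX sP uP (uP * sP * uP⁻¹) uP⁻¹ p.2) := by
  unfold Function.Injective
  decide +kernel

theorem perm_center : ∀ p : Fin 2 × Fin 12,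
    sP * (wordV uP p.1 * wordX sP uP (uP * sP * uP⁻¹) uP⁻¹ p.2) =
      wordV uP p.1 * wordX sP uP (uP * sP * uP⁻¹) uP⁻¹ p.2 * sP →
    (uP * sP * uP⁻¹) * (wordV uP p.1 * wordX sP uP (uP * sP * uP⁻¹) uP⁻¹ p.2) =
      wordV uP p.1 * wordX sP uP (uP * sP * uP⁻¹) uP⁻¹ p.2 * (uP * sP * uP⁻¹) →
    uP ^ 2 * (wordV uP p.1 * wordX sP uP (uP * sP * uP⁻¹) uP⁻¹ p.2) =
      wordV uP p.1 * wordX sP uP (uP * sP * uP⁻¹) uP⁻¹ p.2 * uP ^ 2 →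
    p = (0, 0) := by
  decide +kernel

theorem toP_word (j : Fin 2) (k : Fin 12) : toP (wordV u j * wordX s u x q k) =
    wordV uP j * wordX sP uP (uP * sP * uP⁻¹) uP⁻¹ k := by
  rw [map_mul, map_wordV, map_wordX, toP_s, toP_u, toP_x, toP_q]

/-! A homomorphism into `GL₂(𝔽₁₇)` on which `z ^ 12` is not trivial. -/

abbrev M17 := Matrix (Fin 2) (Fin 2) (ZMod 17)

def sM : M17ˣ := ⟨!![1, 0; 0, 16], !![1, 0; 0, 16], by decide +kernel, by decide +kernel⟩
def uM : M17ˣ := ⟨!![2, 1; 16, 10], !![2, 1; 16, 10] ^ 3, by decide +kernel, by decide +kernel⟩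
def zM : M17ˣ := ⟨!![8, 0; 0, 8], !![15, 0; 0, 15], by decide +kernel, by decide +kernel⟩

def toM : G11 →* M17ˣ :=
  PresentedGroup.toGroup (f := ![sM, sM⁻¹ * zM * uM⁻¹, uM]) (by
    rintro r (rfl | rfl | rfl | rfl | rfl) <;>
      simp only [map_mul, map_inv, map_pow, FreeGroup.lift_apply_of, Matrix.cons_val] <;>
      decide +kernel)

theorem toM_z : toM z = zM := by
  have hs : toM s = sM := PresentedGroup.toGroup.of _
  have ht : toM t = sM⁻¹ * zM * uM⁻¹ := PresentedGroup.toGroup.of _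
  have hu : toM u = uM := PresentedGroup.toGroup.of _
  simp only [z, map_mul, hs, ht, hu]; group

theorem idG :
    q = s * x * u ^ 2 * s ∧ q = x * u ^ 2 * s * x ∧ q * x = s * q ∧ u ^ 2 * q = q * u ^ 2 ∧
    u ^ 2 * q ^ 2 = (z ^ 3) ^ 2 ∧ (z ^ 3) ^ 2 = (s * x * u ^ 2) ^ 3 ∧
    (z ^ 3) ^ 2 = (x * u ^ 2 * s) ^ 3 ∧ (z ^ 3) ^ 8 = 1 :=
  idents rulesG x_eq rfl

theorem z24 : z ^ 24 = 1 := by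
  have := idG.2.2.2.2.2.2.2
  rwa [← pow_mul] at this

theorem order_z6 : orderOf (z ^ 6) = 4 := by
  have h := orderOf_eq_prime_pow (p := 2) (n := 1) (x := z ^ 6) ?_ ?_
  · simpa using h
  · intro h
    have h2 := congrArg toM h
    rw [← pow_mul, map_pow, toM_z, map_one] at h2
    revert h2
    decide +kernel
  · rw [← pow_mul]
    exact z24

theorem mem_zset {y : G11} :
    y ∈ ({1, z ^ 6, z ^ 12, z ^ 18} : Set G11) ↔ ∃ n : ℕ, y = (z ^ 6) ^ n := by
  constructor
  · rintro (h | h | h | h)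
    · exact ⟨0, by rw [h, pow_zero]⟩
    · exact ⟨1, by rw [h, pow_one]⟩
    · exact ⟨2, by rw [h, ← pow_mul]⟩
    · exact ⟨3, by rw [h, ← pow_mul]⟩
  · rintro ⟨n, rfl⟩
    rw [← pow_mod_orderOf (z ^ 6) n, order_z6]
    have : n % 4 < 4 := Nat.mod_lt _ (by norm_num)
    interval_cases n % 4 <;> simp [← pow_mul]

theorem s_mem : s ∈ G13 := Subgroup.subset_closure (by simp)
theorem v_mem : u ^ 2 ∈ G13 := Subgroup.subset_closure (by simp)
theorem x_mem : x ∈ G13 := Subgroup.subset_closure (by simp)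
theorem q_mem : q ∈ G13 := by
  rw [idG.1]
  exact mul_mem (mul_mem (mul_mem s_mem x_mem) v_mem) s_mem

theorem z3sq : (z ^ 3) ^ 2 = z ^ 6 := by rw [← pow_mul]

theorem z6_mem : z ^ 6 ∈ G13 := by
  rw [← z3sq, idG.2.2.2.2.2.1]
  exact pow_mem (mul_mem (mul_mem s_mem x_mem) v_mem) 3

theorem z6_center : z ^ 6 ∈ Subgroup.center G11 := pow_mem z_central 6

theorem wordV_G13 (j : Fin 2) : wordV u j ∈ G13 := by
  fin_cases j
  exacts [one_mem _, v_mem]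

theorem wordX_G13 (k : Fin 12) : wordX s u x q k ∈ G13 := by
  have hs := s_mem
  have hv := v_mem
  have hx := x_mem
  have hq := q_mem
  have hsi := inv_mem hs
  have hxi := inv_mem hx
  have hsv := mul_mem hs hv
  have hqs := mul_mem hq hs
  have hqx := mul_mem hq hxi
  have hsvq := mul_mem hsv hq
  have hqsv := mul_mem hqs hv
  fin_cases k
  exacts [one_mem _, hs, mul_mem hqx hsi, hqx, hsv, mul_mem hsv hs, hq, hqs, hsvq, mul_mem hsvq hs,
    hqsv, mul_mem hqsv hs]

theorem exists_word {g : G11} (hg : g ∈ G13) :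
    ∃ n : ℕ, ∃ i, g = (z ^ 6) ^ n * wordE s u x q i := by
  have T := table rulesG x_eq (show q = u⁻¹ * z ^ 3 from rfl)
  rw [z3sq] at T
  have step : ∀ g y, y ∈ ({s, u ^ 2, x} : Set G11) →
      (∃ n : ℕ, ∃ i, g = (z ^ 6) ^ n * wordE s u x q i) →
      ∃ n : ℕ, ∃ i, g * y = (z ^ 6) ^ n * wordE s u x q i := by
    rintro g y hy ⟨n, i, rfl⟩
    rcases hy with rfl | rfl | rfl
    · exact ⟨n, _, by rw [mul_assoc, (T i).1]⟩
    · exact ⟨n + expV i, _, by rw [mul_assoc, (T i).2.1, pow_add, mul_assoc]⟩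
    · exact ⟨n + expX i, _, by rw [mul_assoc, (T i).2.2, pow_add, mul_assoc]⟩
  have hss : s * s = 1 := rulesG.ss
  have hinv : ∀ y ∈ ({s, u ^ 2, x} : Set G11), y⁻¹ = y := by
    rintro y (rfl | rfl | rfl)
    · exact inv_eq_of_mul_eq_one_left hss
    · exact inv_eq_of_mul_eq_one_left (by rw [← pow_add]; exact u_four)
    · have hs : s⁻¹ = s := inv_eq_of_mul_eq_one_left hss
      rw [x_eq, mul_inv_rev, mul_inv_rev, inv_inv, hs, mul_assoc]
  induction hg using Subgroup.closure_induction_right with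
  | one => exact ⟨0, 0, by simp [wordE]⟩
  | mul_right g _ y hy ih => exact step g y hy ih
  | mul_inv_cancel g _ y hy ih =>
    rw [hinv y hy]
    exact step g y hy ih

theorem exists_word' {g : G11} (hg : g ∈ G13) :
    ∃ n : ℕ, ∃ j k, g = (z ^ 6) ^ n * (wordV u j * wordX s u x q k) := by
  obtain ⟨n, i, rfl⟩ := exists_word hg
  obtain ⟨j, k, h⟩ := wordE_eq s u x q i
  exact ⟨n, j, k, by rw [h]⟩

theorem toP_z6 (n : ℕ) : toP ((z ^ 6) ^ n) = 1 := by
  rw [map_pow, map_pow, toP_z, one_pow, one_pow]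

theorem mem_map_center {g : G11} : g ∈ (Subgroup.center ↥G13).map G13.subtype ↔
    g ∈ G13 ∧ ∀ h ∈ G13, h * g = g * h := by
  constructor
  · rintro ⟨c, hc, rfl⟩
    refine ⟨c.2, fun h hh => ?_⟩
    have := Subgroup.mem_center_iff.1 hc ⟨h, hh⟩
    exact congrArg Subtype.val this
  · rintro ⟨hg, hc⟩
    refine ⟨⟨g, hg⟩, ?_, rfl⟩
    rw [SetLike.mem_coe, Subgroup.mem_center_iff]
    rintro ⟨h, hh⟩
    exact Subtype.ext (hc h hh)

theorem center_le {g : G11} (hg : g ∈ (Subgroup.center ↥G13).map G13.subtype) :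
    g ∈ Subgroup.zpowers (z ^ 6) := by
  obtain ⟨hg, hc⟩ := mem_map_center.1 hg
  obtain ⟨n, j, k, rfl⟩ := exists_word' hg
  have e : toP ((z ^ 6) ^ n * (wordV u j * wordX s u x q k)) =
      wordV uP j * wordX sP uP (uP * sP * uP⁻¹) uP⁻¹ k := by
    rw [map_mul, toP_z6, one_mul, toP_word]
  have h1 := congrArg toP (hc s s_mem)
  have h2 := congrArg toP (hc x x_mem)
  have h3 := congrArg toP (hc _ v_mem)
  rw [map_mul, map_mul _ _ s, e, toP_s] at h1
  rw [map_mul, map_mul _ _ x, e, toP_x] at h2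
  rw [map_mul, map_mul _ _ (u ^ 2), e, map_pow, toP_u] at h3
  have := perm_center (j, k) h1 h2 h3
  obtain ⟨rfl, rfl⟩ := Prod.mk.inj this
  have e2 : wordV u 0 * wordX s u x q 0 = 1 := mul_one 1
  rw [e2, mul_one]
  exact Subgroup.npow_mem_zpowers _ _

theorem center_eq1 : (Subgroup.center ↥G13).map G13.subtype = Subgroup.zpowers (z ^ 6) := by
  refine le_antisymm (fun g hg => center_le hg) ?_
  rw [Subgroup.zpowers_le, mem_map_center]
  exact ⟨z6_mem, fun h _ => z_comm 6 h⟩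

theorem center_eq2 :
    (Subgroup.center ↥G13).map G13.subtype = G13 ⊓ Subgroup.center G11 := by
  apply le_antisymm
  · rw [center_eq1, Subgroup.zpowers_le]
    exact ⟨z6_mem, z6_center⟩
  · rintro g ⟨h1, h2⟩
    exact mem_map_center.2 ⟨h1, fun h _ => Subgroup.mem_center_iff.1 h2 h⟩

theorem statement15 :
    x = u * s * u⁻¹ ∧
    q = s * x * u ^ 2 * s ∧
    q = x * u ^ 2 * s * x ∧
    q * x = s * q ∧
    u ^ 2 * q = q * u ^ 2 ∧
    u ^ 2 * q ^ 2 = z ^ 6 ∧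
    z ^ 6 = (s * x * u ^ 2) ^ 3 ∧
    z ^ 6 = (x * u ^ 2 * s) ^ 3 ∧
    orderOf (z ^ 6) = 4 ∧
    (Subgroup.center ↥G13).map G13.subtype = Subgroup.zpowers (z ^ 6) ∧
    (Subgroup.center ↥G13).map G13.subtype = G13 ⊓ Subgroup.center G11 ∧
    Set.BijOn (fun p : G11 × G11 × G11 => p.1 * p.2.1 * p.2.2)
      (({1, z ^ 6, z ^ 12, z ^ 18} : Set G11) ×ˢ (({1, u ^ 2} : Set G11) ×ˢ ({1, s, q * x⁻¹ * s⁻¹, q * x⁻¹, s * u ^ 2, s * u ^ 2 * s, q, q * s, s * u ^ 2 * q, s * u ^ 2 * q * s, q * s * u ^ 2, q * s * u ^ 2 * s} : Set G11)))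
      (G13 : Set G11) := by
  obtain ⟨h1, h2, h3, h4, h5, h6, h7, -⟩ := idG
  rw [z3sq] at h5 h6 h7
  refine ⟨x_eq, h1, h2, h3, h4, h5, h6, h7, order_z6, center_eq1, center_eq2, ?_, ?_, ?_⟩
  · rintro ⟨y, v, g⟩ ⟨hy, hv, hg⟩
    obtain ⟨n, hn⟩ := mem_zset.1 hy
    obtain ⟨j, hj⟩ := mem_V hv
    obtain ⟨k, hk⟩ := mem_X hg
    simp only at hn hj hk
    subst hn hj hk
    exact mul_mem (mul_mem (pow_mem z6_mem n) (wordV_G13 j)) (wordX_G13 k)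
  · rintro ⟨y, v, g⟩ ⟨hy, hv, hg⟩ ⟨y', v', g'⟩ ⟨hy', hv', hg'⟩ h
    obtain ⟨n, hn⟩ := mem_zset.1 hy
    obtain ⟨j, hj⟩ := mem_V hv
    obtain ⟨k, hk⟩ := mem_X hg
    obtain ⟨n', hn'⟩ := mem_zset.1 hy'
    obtain ⟨j', hj'⟩ := mem_V hv'
    obtain ⟨k', hk'⟩ := mem_X hg'
    simp only at hn hj hk hn' hj' hk' h
    subst hn hj hk hn' hj' hk'
    have h0 := congrArg toP h
    rw [mul_assoc, mul_assoc, map_mul, map_mul toP ((z ^ 6) ^ n'), toP_z6, toP_z6, one_mul, one_mul,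
      toP_word, toP_word] at h0
    have hp : ((j, k) : Fin 2 × Fin 12) = (j', k') := perm_inj h0
    obtain ⟨rfl, rfl⟩ := Prod.mk.inj hp
    rw [mul_left_inj, mul_left_inj] at h
    rw [h]
  · intro g hg
    obtain ⟨n, j, k, rfl⟩ := exists_word' hg
    exact ⟨((z ^ 6) ^ n, wordV u j, wordX s u x q k),
      ⟨mem_zset.2 ⟨n, rfl⟩, wordV_mem u j, wordX_mem s u x q k⟩, mul_assoc _ _ _⟩

end Octa
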